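/- Let p be a prime, let q be a prime power, and let G be a minimal irreducible ESQ-subgroup of GL_p(F_q) that is absolutely irreducible but not simple. Then |G| = p·r^s where r is a prime different from p with r dividing q − 1 (i.e., ord_r(q) = 1) and s = ord_p(r) is the multiplicative order of r modulo p; moreover the derived subgroup G' is elementary abelian of order r^s, and G/G' has order p and acts irreducibly on G' by conjugation. -/

import Mathlib

open TensorProduct

section ExteriorSquare

variable (F : Type*) [Field F] (V : Type*) [AddCommGroup V] [Module F V]

/-- The submodule of `V ⊗ V` spanned by the squares `v ⊗ v`. -/
def sqSub : Submodule F (V ⊗[F] V) :=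
  Submodule.span F {x : V ⊗[F] V | ∃ v : V, x = v ⊗ₜ[F] v}

/-- The exterior square `Λ²V`, realised as `V ⊗ V` modulo the squares. -/
abbrev Wedge2 := (V ⊗[F] V) ⧸ sqSub F V

variable {F V}

/-- The map `Λ²g = g ∧ g` induced on the exterior square by `g : V → V`. -/
noncomputable def wedge2Map (g : V →ₗ[F] V) : Wedge2 F V →ₗ[F] Wedge2 F V :=
  Submodule.mapQ _ _ (TensorProduct.map g g) (by
    rw [← Submodule.map_le_iff_le_comap, sqSub, Submodule.map_span]
    refine Submodule.span_le.2 ?_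
    rintro _ ⟨_, ⟨v, rfl⟩, rfl⟩
    exact Submodule.subset_span ⟨g v, by simp⟩)

end ExteriorSquare

section LinearGroups

variable {n : ℕ} {F : Type*} [Field F]

/-- The natural action of `g ∈ GL_n(F)` on row vectors. -/
def natAct (g : GL (Fin n) F) : (Fin n → F) →ₗ[F] (Fin n → F) :=
  Matrix.vecMulLinear (g : Matrix (Fin n) (Fin n) F)

/-- `G ≤ GL_n(F)` acts irreducibly on the natural module `F^n`. -/
def IsIrred (G : Subgroup (GL (Fin n) F)) : Prop :=
  ∀ S : Submodule F (Fin n → F),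
    (∀ g ∈ G, Submodule.map (natAct g) S = S) → S = ⊥ ∨ S = ⊤

/-- The natural module `F^n` is an exterior self-quotient (ESQ) module for
`G ≤ GL_n(F)`: there is a `G`-invariant submodule `U ≤ Λ²(F^n)` and a
`G`-equivariant isomorphism `Λ²(F^n)/U ≃ F^n`. -/
def IsESQ (G : Subgroup (GL (Fin n) F)) : Prop :=
  ∃ (U : Submodule F (Wedge2 F (Fin n → F)))
    (e : ((Wedge2 F (Fin n → F)) ⧸ U) ≃ₗ[F] (Fin n → F)),
    (∀ g ∈ G, Submodule.map (wedge2Map (natAct g)) U ≤ U) ∧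
    ∀ g ∈ G, ∀ w : Wedge2 F (Fin n → F),
      e (Submodule.Quotient.mk (wedge2Map (natAct g) w)) =
        natAct g (e (Submodule.Quotient.mk w))

/-- `G ≤ GL_n(F)` is absolutely irreducible: it remains irreducible over the
algebraic closure of `F`. -/
def IsAbsIrred (G : Subgroup (GL (Fin n) F)) : Prop :=
  ∀ S : Submodule (AlgebraicClosure F) (Fin n → AlgebraicClosure F),
    (∀ g ∈ G, Submodule.map
        (Matrix.vecMulLinear
          ((g : Matrix (Fin n) (Fin n) F).map (algebraMap F (AlgebraicClosure F)))) S = S) →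
      S = ⊥ ∨ S = ⊤

/-- `G` is a minimal irreducible ESQ-subgroup of `GL_n(F)`: it is irreducible,
the natural module is ESQ for `G`, and every proper subgroup acts reducibly. -/
def IsMinIrredESQ (G : Subgroup (GL (Fin n) F)) : Prop :=
  IsIrred G ∧ IsESQ G ∧
    ∀ H : Subgroup (GL (Fin n) F), H < G → ¬ IsIrred H

end LinearGroups

section Clifford

open Module
open scoped Pointwise

variable {F V G : Type*} [Field F] [AddCommGroup V] [Module F V] [Group G]
  [DistribMulAction G V]

variable (F V) in
/-- `V` has no proper nonzero `H`-invariant subspace. -/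
def IrreducibleUnder (H : Subgroup G) : Prop :=
  ∀ S : Submodule F V, (∀ h ∈ H, ∀ v ∈ S, h • v ∈ S) → S = ⊥ ∨ S = ⊤

/-- The subspace on which a subgroup `B` acts through the scalar-valued function `χ`. -/
def weightSpace [SMulCommClass G F V] (B : Subgroup G) (χ : B → F) : Submodule F V where
  carrier := {v | ∀ b : B, (b : G) • v = χ b • v}
  add_mem' hv hw b := by rw [smul_add, smul_add, hv b, hw b]
  zero_mem' b := by simp
  smul_mem' c v hv b := by rw [smul_comm, hv b, smul_comm]

variable [SMulCommClass G F V]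

theorem mem_weightSpace {B : Subgroup G} {χ : B → F} {v : V} :
    v ∈ weightSpace B χ ↔ ∀ b : B, (b : G) • v = χ b • v := Iff.rfl

theorem smul_mem_weightSpace {B : Subgroup G} {χ : B → F} {v : V}
    (hv : v ∈ weightSpace B χ) {b : G} (hb : b ∈ B) : b • v ∈ weightSpace B χ := by
  rw [hv ⟨b, hb⟩]
  exact Submodule.smul_mem _ _ hv

theorem iSupIndep_weightSpace (B : Subgroup G) :
    iSupIndep (weightSpace B : (B → F) → Submodule F V) := by
  classical
  rw [iSupIndep_iff_finsetSum_eq_zero_imp_eq_zero]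
  intro s
  induction s using Finset.induction_on with
  | empty => simp
  | insert ψ s hψ ih =>
    intro v hv hsum
    have hz : ∀ χ ∈ s, v χ = 0 := by
      intro χ hχ
      obtain ⟨b, hb⟩ : ∃ b, χ b ≠ ψ b :=
        Function.ne_iff.1 (fun h => hψ (h ▸ hχ))
      have hsum' : ∑ i ∈ s, (i b - ψ b) • v i = 0 := by
        have h1 : ∑ i ∈ insert ψ s, (i b - ψ b) • v i = 0 := by
          have h2 : ∑ i ∈ insert ψ s, i b • v i = 0 := by
            have h3 := congrArg (fun x => (b : G) • x) hsum
            simp only [smul_zero, Finset.smul_sum] at h3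
            rw [← h3]
            exact Finset.sum_congr rfl fun i hi => (hv i hi b).symm
          simp only [sub_smul, Finset.sum_sub_distrib]
          rw [h2, ← Finset.smul_sum, hsum, smul_zero, sub_zero]
        rwa [Finset.sum_insert hψ, sub_self, zero_smul, zero_add] at h1
      have := ih (fun i => (i b - ψ b) • v i)
        (fun i hi => Submodule.smul_mem _ _ (hv i (Finset.mem_insert_of_mem hi))) hsum' χ hχ
      exact (smul_eq_zero.1 this).resolve_left (sub_ne_zero.2 hb)
    intro i hi
    rcases Finset.mem_insert.1 hi with rfl | hi
    · rwa [Finset.sum_insert hψ, Finset.sum_eq_zero hz, add_zero] at hsum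
    · exact hz i hi

theorem exists_smul_weightSpace_eq {B : Subgroup G} (hB : B.Normal) (g : G) (χ : B → F) :
    ∃ ψ : B → F, g • (weightSpace B χ : Submodule F V) = weightSpace B ψ := by
  refine ⟨fun b => χ ⟨g⁻¹ * b * g, hB.conj_mem' _ b.2 g⟩, ?_⟩
  ext v
  rw [Submodule.mem_smul_pointwise_iff_exists]
  constructor
  · rintro ⟨w, hw, rfl⟩ b
    have := congrArg (fun x => g • x) (hw ⟨g⁻¹ * b * g, hB.conj_mem' _ b.2 g⟩)
    simp only [smul_smul] at this
    rw [smul_smul, ← smul_comm, ← this]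
    group
  · intro hv
    refine ⟨g⁻¹ • v, fun b => ?_, smul_inv_smul _ _⟩
    have := congrArg (fun x => g⁻¹ • x) (hv ⟨g * b * g⁻¹, hB.conj_mem _ b.2 g⟩)
    simp only [smul_smul] at this
    rw [smul_smul, ← smul_comm]
    convert this using 2
    · group
    · congr 2
      group

/-- A nonzero subspace has translates spanning an irreducible module. -/
theorem iSup_smul_eq_top (hirr : IrreducibleUnder F V (⊤ : Subgroup G)) {W : Submodule F V}
    (hW : W ≠ ⊥) : ⨆ g : G, g • W = ⊤ := by
  refine (hirr _ fun h _ v hv => ?_).resolve_left fun h => hW ?_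
  · have h1 : h • v ∈ h • ⨆ g : G, g • W := Submodule.smul_mem_pointwise_smul _ _ _ hv
    refine (?_ : h • ⨆ g : G, g • W ≤ _) h1
    rw [Submodule.pointwise_smul_def, Submodule.map_iSup]
    refine iSup_le fun g => ?_
    rw [← Submodule.pointwise_smul_def, smul_smul]
    exact le_iSup (fun g : G => g • W) (h * g)
  · have := le_iSup (fun g : G => g • W) 1
    rwa [h, one_smul, le_bot_iff] at this

theorem finrank_pointwise_smul (g : G) (W : Submodule F V) :
    finrank F (g • W : Submodule F V) = finrank F W :=
  (DistribMulAction.toLinearEquiv F V g).finrank_map_eq W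

/-- A minimal invariant subspace for a normal subgroup acting reducibly on an irreducible module
of prime dimension is a line. -/
theorem finrank_eq_one_of_minimal (hp : (finrank F V).Prime)
    (hirr : IrreducibleUnder F V (⊤ : Subgroup G)) {B : Subgroup G} (hB : B.Normal)
    (hred : ¬ IrreducibleUnder F V B) {W : Submodule F V} (hW : W ≠ ⊥)
    (hinv : ∀ b ∈ B, ∀ v ∈ W, b • v ∈ W)
    (hmin : ∀ U ≤ W, (∀ b ∈ B, ∀ v ∈ U, b • v ∈ U) → U = ⊥ ∨ U = W) :
    finrank F W = 1 := by
  have : FiniteDimensional F V := FiniteDimensional.of_finrank_pos hp.pos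
  have hdvd : finrank F W ∣ finrank F V := by
    let T : Set (Submodule F V) :=
      {U | (∀ b ∈ B, ∀ v ∈ U, b • v ∈ U) ∧ finrank F W ∣ finrank F U}
    have hT : T.Nonempty := ⟨⊥, by
      refine ⟨fun b _ v hv => ?_, by simp⟩
      rw [(Submodule.mem_bot F).1 hv, smul_zero]
      exact zero_mem _⟩
    obtain ⟨U, ⟨hU, hUd⟩, hmax⟩ := WellFounded.has_min
      (wellFounded_gt : WellFounded ((· > ·) : Submodule F V → _ → Prop)) T hT
    suffices h : U = ⊤ by rwa [h, finrank_top] at hUd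
    by_contra hne
    obtain ⟨g, hg⟩ : ∃ g : G, ¬ g • W ≤ U := by
      by_contra! h
      exact hne (top_le_iff.1 ((iSup_smul_eq_top hirr hW).symm.le.trans (iSup_le h)))
    have hgW : ∀ b ∈ B, ∀ v ∈ g • W, b • v ∈ g • W := by
      intro b hb v hv
      obtain ⟨w, hw, rfl⟩ := (Submodule.mem_smul_pointwise_iff_exists _ _ _).1 hv
      have := Submodule.smul_mem_pointwise_smul _ g _
        (hinv _ (hB.conj_mem' b hb g) w hw)
      rwa [smul_smul, mul_assoc, mul_inv_cancel_left, ← smul_smul] at this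
    have hinf : g • W ⊓ U = ⊥ := by
      rcases hmin (g⁻¹ • (g • W ⊓ U)) (by
          intro x hx
          obtain ⟨y, hy, rfl⟩ := (Submodule.mem_smul_pointwise_iff_exists _ _ _).1 hx
          obtain ⟨w, hw, rfl⟩ := (Submodule.mem_smul_pointwise_iff_exists _ _ _).1 hy.1
          rwa [inv_smul_smul]) (by
          intro b hb x hx
          obtain ⟨y, hy, rfl⟩ := (Submodule.mem_smul_pointwise_iff_exists _ _ _).1 hx
          have hb' := hB.conj_mem b hb g
          have := Submodule.smul_mem_pointwise_smul _ g⁻¹ (g • W ⊓ U)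
            ⟨hgW _ hb' y hy.1, hU _ hb' y hy.2⟩
          rwa [smul_smul, mul_assoc, inv_mul_cancel_left, ← smul_smul] at this) with h | h
      · rw [inv_smul_eq_iff] at h
        rw [h, Submodule.pointwise_smul_def, Submodule.map_bot]
      · rw [inv_smul_eq_iff] at h
        exact absurd (inf_eq_left.1 h) hg
    have hlt : U < g • W ⊔ U := lt_of_le_of_ne le_sup_right fun h => hg (h ▸ le_sup_left)
    refine hmax _ ⟨fun b hb v hv => ?_, ?_⟩ hlt
    · obtain ⟨x, hx, y, hy, rfl⟩ := Submodule.mem_sup.1 hv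
      rw [smul_add]
      exact Submodule.add_mem_sup (hgW b hb x hx) (hU b hb y hy)
    · have := Submodule.finrank_sup_add_finrank_inf_eq (g • W) U
      rw [hinf, finrank_bot, add_zero, finrank_pointwise_smul] at this
      rw [this]
      exact dvd_add dvd_rfl hUd
  refine (hp.eq_one_or_self_of_dvd _ hdvd).resolve_right fun h => hred fun S hS => ?_
  have hWtop : W = ⊤ := Submodule.eq_top_of_finrank_eq h
  subst hWtop
  exact hmin S le_top hS

/-- Every nonzero invariant subspace contains a weight vector. -/
theorem exists_mem_weightSpace (hp : (finrank F V).Prime)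
    (hirr : IrreducibleUnder F V (⊤ : Subgroup G)) {B : Subgroup G} (hB : B.Normal)
    (hred : ¬ IrreducibleUnder F V B) {S : Submodule F V} (hS : S ≠ ⊥)
    (hinv : ∀ b ∈ B, ∀ v ∈ S, b • v ∈ S) :
    ∃ χ : B → F, ∃ v ∈ S, v ≠ 0 ∧ v ∈ weightSpace B χ := by
  have : FiniteDimensional F V := FiniteDimensional.of_finrank_pos hp.pos
  obtain ⟨W, ⟨hWS, hW, hWinv⟩, hmin⟩ := WellFounded.has_min
    (wellFounded_lt : WellFounded ((· < ·) : Submodule F V → _ → Prop))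
    {U | U ≤ S ∧ U ≠ ⊥ ∧ ∀ b ∈ B, ∀ v ∈ U, b • v ∈ U} ⟨S, le_rfl, hS, hinv⟩
  have h1 := finrank_eq_one_of_minimal hp hirr hB hred hW hWinv fun U hUW hU => by
    by_contra! h
    exact hmin U ⟨hUW.trans hWS, h.1, hU⟩ (lt_of_le_of_ne hUW h.2)
  obtain ⟨⟨w, hw⟩, hw0, hspan⟩ := finrank_eq_one_iff'.1 h1
  choose c hc using hspan
  refine ⟨fun b => c ⟨b • w, hWinv b b.2 w hw⟩, w, hWS hw, by simpa using hw0, fun b => ?_⟩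
  exact (congrArg Subtype.val (hc ⟨b • w, hWinv b b.2 w hw⟩)).symm

/-- The number and dimension of the translates of a weight space of a normal subgroup that does
not act by scalars. -/
theorem orbit_weightSpace [Finite G] (hp : (finrank F V).Prime)
    (hirr : IrreducibleUnder F V (⊤ : Subgroup G)) {B : Subgroup G} (hB : B.Normal)
    (hscal : ∀ χ : B → F, (weightSpace B χ : Submodule F V) ≠ ⊤) {χ : B → F}
    (hχ : (weightSpace B χ : Submodule F V) ≠ ⊥) :
    finrank F (weightSpace B χ : Submodule F V) = 1 ∧
      Nat.card (MulAction.orbit G (weightSpace B χ : Submodule F V)) = finrank F V := by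
  classical
  have : FiniteDimensional F V := FiniteDimensional.of_finrank_pos hp.pos
  set E : Submodule F V := weightSpace B χ with hE
  let Y := MulAction.orbit G E
  have : Finite Y := Finite.Set.finite_range _
  have := Fintype.ofFinite Y
  have hY : ∀ y : Y, ∃ ψ : B → F, (y : Submodule F V) = weightSpace B ψ := by
    rintro ⟨_, g, rfl⟩
    exact exists_smul_weightSpace_eq hB g χ
  choose f hf using hY
  have hind : iSupIndep fun y : Y => (y : Submodule F V) := by
    have := (iSupIndep_weightSpace (F := F) (V := V) B).comp (f := f) fun x y hxy =>
      Subtype.ext (by rw [hf, hf, hxy])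
    convert this using 2 with y
    exact hf y
  have htop : ⨆ y : Y, (y : Submodule F V) = ⊤ := by
    rw [eq_top_iff, ← iSup_smul_eq_top hirr hχ]
    exact iSup_le fun g => le_iSup (fun y : Y => (y : Submodule F V)) ⟨g • E, g, rfl⟩
  have hcard : Fintype.card Y * finrank F E = finrank F V := by
    have hint := DirectSum.isInternal_submodule_of_iSupIndep_of_iSup_eq_top hind htop
    rw [← (LinearEquiv.ofBijective (DirectSum.coeLinearMap fun y : Y => (y : Submodule F V))
      hint).finrank_eq, finrank_directSum, Finset.sum_congr rfl (g := fun _ => finrank F E)]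
    · simp
    · rintro ⟨_, g, rfl⟩ _
      exact finrank_pointwise_smul g E
  have h1 : finrank F E = 1 := by
    refine (hp.eq_one_or_self_of_dvd _ ⟨_, by rw [mul_comm, hcard]⟩).resolve_right fun h => ?_
    exact hscal χ (Submodule.eq_top_of_finrank_eq h)
  rw [h1, mul_one] at hcard
  exact ⟨h1, by rw [Nat.card_eq_fintype_card, hcard]⟩

/-- A minimal irreducible linear group of prime degree that is not simple and has no nontrivial
scalars is an extension of an abelian minimal normal subgroup by a group of order equal to the
degree. -/
theorem exists_minimal_normal_of_minimal_irreducible [Finite G] [FaithfulSMul G V]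
    (hp : (finrank F V).Prime) (hirr : IrreducibleUnder F V (⊤ : Subgroup G))
    (hmin : ∀ H : Subgroup G, H ≠ ⊤ → ¬ IrreducibleUnder F V H)
    (hscal : ∀ (g : G) (c : F), (∀ v : V, g • v = c • v) → g = 1) (hns : ¬ IsSimpleGroup G) :
    ∃ (A : Subgroup G) (g : G), A.Normal ∧ A ≠ ⊥ ∧ (∀ a ∈ A, ∀ b ∈ A, a * b = b * a) ∧
      A.index = finrank F V ∧ A ⊔ Subgroup.zpowers g = ⊤ ∧
      (∀ a ∈ A, a * g = g * a → a = 1) ∧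
      (∀ B ≤ A, B.Normal → B = ⊥ ∨ B = A) ∧
      ∀ r : ℕ, (∀ a ∈ A, a ^ r = 1) → ∃ c : F, c ^ r = 1 ∧ c ≠ 1 := by
  classical
  have : FiniteDimensional F V := FiniteDimensional.of_finrank_pos hp.pos
  have hVnt : Nontrivial V := Module.nontrivial_of_finrank_pos hp.pos
  have hline : ∀ W : Submodule F V, finrank F W = 1 → W ≠ ⊥ ∧ W ≠ ⊤ := by
    refine fun W hW => ⟨?_, ?_⟩ <;> rintro rfl
    · simp at hW
    · rw [finrank_top] at hW
      exact hp.one_lt.ne' hW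
  have hweight : ∀ B : Subgroup G, B ≠ ⊥ → ∀ χ : B → F,
      (weightSpace B χ : Submodule F V) ≠ ⊤ := fun B hB χ h => hB <|
    (Subgroup.eq_bot_iff_forall _).2 fun b hb =>
      hscal b (χ ⟨b, hb⟩) fun v => mem_weightSpace.1 (h ▸ Submodule.mem_top) ⟨b, hb⟩
  have hGnt : Nontrivial G := by
    by_contra h
    rw [not_nontrivial_iff_subsingleton] at h
    obtain ⟨v, hv⟩ := exists_ne (0 : V)
    have h1 := hline _ (finrank_span_singleton (K := F) hv)
    rcases hirr (F ∙ v) (fun g _ w hw => by rwa [Subsingleton.elim g 1, one_smul]) with h | h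
    exacts [h1.1 h, h1.2 h]
  obtain ⟨N, hN, hNbot, hNtop⟩ : ∃ N : Subgroup G, N.Normal ∧ N ≠ ⊥ ∧ N ≠ ⊤ := by
    by_contra! h
    exact hns ⟨fun N hN => or_iff_not_imp_left.2 (h N hN)⟩
  obtain ⟨χ₀, v₀, -, hv₀, hv₀χ⟩ := exists_mem_weightSpace hp hirr hN (hmin N hNtop)
    (S := ⊤) top_ne_bot fun _ _ _ _ => Submodule.mem_top
  set E : Submodule F V := weightSpace N χ₀ with hE
  have hEbot : E ≠ ⊥ := (Submodule.ne_bot_iff _).2 ⟨v₀, hv₀χ, hv₀⟩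
  obtain ⟨hE1, hcard⟩ := orbit_weightSpace hp hirr hN (hweight N hNbot) hEbot
  let X := MulAction.orbit G E
  have hXfin : Finite X := Finite.Set.finite_range _
  have := Fintype.ofFinite X
  have hX1 : ∀ x : X, finrank F (x : Submodule F V) = 1 := by
    rintro ⟨_, g, rfl⟩
    exact (finrank_pointwise_smul g E).trans hE1
  have hXtop : ∀ S : Submodule F V, (∀ x : X, (x : Submodule F V) ≤ S) → S = ⊤ := by
    intro S hS
    rw [eq_top_iff, ← iSup_smul_eq_top hirr hEbot]
    exact iSup_le fun g => hS ⟨g • E, g, rfl⟩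
  have hext : ∀ f k : Module.End F V, (∀ x : X, ∀ v ∈ (x : Submodule F V), f v = k v) →
      ∀ v, f v = k v := by
    intro f k h v
    have h1 := hXtop (LinearMap.eqLocus f k) fun x v hv => h x v hv
    have h2 : v ∈ LinearMap.eqLocus f k := h1 ▸ Submodule.mem_top
    exact h2
  let φ := MulAction.toPermHom G X
  set A : Subgroup G := φ.ker with hA
  have hAX : ∀ a ∈ A, ∀ x : X, a • (x : Submodule F V) = x := fun a ha x =>
    congrArg Subtype.val (congrArg (fun s : Equiv.Perm X => s x) (MonoidHom.mem_ker.1 ha))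
  have hNA : N ≤ A := by
    intro n hn
    refine MonoidHom.mem_ker.2 (Equiv.ext ?_)
    rintro ⟨_, g, rfl⟩
    refine Subtype.ext ?_
    change n • (g • E) = g • E
    obtain ⟨ψ, hψ⟩ := exists_smul_weightSpace_eq (F := F) (V := V) hN g χ₀
    rw [hE, hψ]
    refine le_antisymm ?_ ?_
    · intro v hv
      obtain ⟨w, hw, rfl⟩ := (Submodule.mem_smul_pointwise_iff_exists _ _ _).1 hv
      exact smul_mem_weightSpace hw hn
    · intro v hv
      exact (Submodule.mem_smul_pointwise_iff_exists _ _ _).2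
        ⟨n⁻¹ • v, smul_mem_weightSpace hv (N.inv_mem hn), smul_inv_smul _ _⟩
  have hAbot : A ≠ ⊥ := fun h => hNbot (le_bot_iff.1 (h ▸ hNA))
  have hAtop : A ≠ ⊤ := by
    intro h
    have h1 := hline E hE1
    rcases hirr E (fun g _ v hv => by
      have h2 : g • E = E := hAX g (h ▸ Subgroup.mem_top g) ⟨E, MulAction.mem_orbit_self E⟩
      have h3 := Submodule.smul_mem_pointwise_smul v g E hv
      rwa [h2] at h3) with h | h
    exacts [h1.1 h, h1.2 h]
  have hχ : ∀ x : X, ∃ χ : A → F, (x : Submodule F V) ≤ weightSpace A χ := by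
    intro x
    obtain ⟨⟨w, hw⟩, -, hspan⟩ := finrank_eq_one_iff'.1 (hX1 x)
    have hinv : ∀ a : A, (a : G) • w ∈ (x : Submodule F V) := fun a => by
      have := Submodule.smul_mem_pointwise_smul w (a : G) _ hw
      rwa [hAX a a.2] at this
    choose c hc using hspan
    refine ⟨fun a => c ⟨_, hinv a⟩, fun v hv a => ?_⟩
    have h1 : (a : G) • w = _ := (congrArg Subtype.val (hc ⟨_, hinv a⟩)).symm
    have h2 : v = c ⟨v, hv⟩ • w := (congrArg Subtype.val (hc ⟨v, hv⟩)).symm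
    rw [h2, smul_comm, h1]
    exact smul_comm _ _ _
  choose χ hχ using hχ
  have htrans : MulAction.IsPretransitive G X := inferInstance
  obtain ⟨g, hg⟩ : ∃ g : G, orderOf (φ g) = finrank F V := by
    have : Fact (finrank F V).Prime := ⟨hp⟩
    have hdvd : finrank F V ∣ Nat.card φ.range := by
      rw [← Subgroup.index_ker, ← hcard,
        ← MulAction.index_stabilizer_of_transitive G (⟨E, MulAction.mem_orbit_self E⟩ : X)]
      refine Subgroup.index_dvd_of_le fun a ha => ?_
      exact Subtype.ext (hAX a ha _)
    obtain ⟨⟨_, g, rfl⟩, hσ⟩ := exists_prime_orderOf_dvd_card' _ hdvd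
    exact ⟨g, by rwa [← Subgroup.orderOf_coe] at hσ⟩
  have hcyc : ∀ x y : X, ∃ i : ℤ, g ^ i • (x : Submodule F V) = y := by
    have hc : Fintype.card X = finrank F V := by rw [← Nat.card_eq_fintype_card, hcard]
    have hcycle : (φ g).IsCycle :=
      Equiv.Perm.isCycle_of_prime_order'' (hc ▸ hp) (hg.trans hc.symm)
    have hsupp : (φ g).support = Finset.univ := by
      rw [← Finset.card_eq_iff_eq_univ, ← hcycle.orderOf, hg, hc]
    intro x y
    obtain ⟨i, hi⟩ := hcycle.exists_zpow_eq
      (Equiv.Perm.mem_support.1 (hsupp ▸ Finset.mem_univ x))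
      (Equiv.Perm.mem_support.1 (hsupp ▸ Finset.mem_univ y))
    refine ⟨i, ?_⟩
    rw [← map_zpow] at hi
    exact congrArg Subtype.val hi
  have hcent : ∀ a ∈ A, a * g = g * a → a = 1 := by
    intro a ha hag
    let x : X := ⟨E, MulAction.mem_orbit_self E⟩
    refine hscal a (χ x ⟨a, ha⟩) (hext (DistribSMul.toLinearMap F V a)
      (LinearMap.lsmul F V (χ x ⟨a, ha⟩)) fun y v hv => ?_)
    obtain ⟨i, hi⟩ := hcyc x y
    rw [← hi] at hv
    obtain ⟨w, hw, rfl⟩ := (Submodule.mem_smul_pointwise_iff_exists _ _ _).1 hv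
    have h1 : a • w = χ x ⟨a, ha⟩ • w := hχ x hw ⟨a, ha⟩
    have h2 : a * g ^ i = g ^ i * a := (Commute.zpow_right hag i)
    change a • g ^ i • w = χ x ⟨a, ha⟩ • g ^ i • w
    rw [smul_smul, h2, ← smul_smul, h1, smul_comm]
  have hBirr : ∀ B ≤ A, B.Normal → B ≠ ⊥ → B ⊔ Subgroup.zpowers g = ⊤ := by
    intro B hBA hB hBbot
    by_contra hne
    refine hmin _ hne fun S hS => or_iff_not_imp_left.2 fun hSbot => ?_
    have hBtop : B ≠ ⊤ := fun h => hAtop (top_le_iff.1 (h ▸ hBA))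
    obtain ⟨ψ, w, hwS, hw0, hwψ⟩ := exists_mem_weightSpace hp hirr hB (hmin B hBtop) hSbot
      fun b hb => hS b (Subgroup.mem_sup_left hb)
    obtain ⟨x, hx⟩ : ∃ x : X, (x : Submodule F V) = weightSpace B ψ := by
      by_contra! hne
      let ξ : X → B → F := fun x b => χ x ⟨b, hBA b.2⟩
      have hξ : ∀ x : X, (x : Submodule F V) = weightSpace B (ξ x) := by
        intro x
        have hle : (x : Submodule F V) ≤ weightSpace B (ξ x) :=
          fun v hv b => hχ x hv ⟨b, hBA b.2⟩
        refine Submodule.eq_of_le_of_finrank_eq hle ?_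
        rw [hX1, (orbit_weightSpace hp hirr hB (hweight B hBbot) fun h => ?_).1]
        exact (hline _ (hX1 x)).1 (le_bot_iff.1 (h ▸ hle))
      have htop := hXtop (⨆ (η : B → F) (_ : η ≠ ψ), weightSpace B η) fun x => by
        rw [hξ]
        exact le_iSup₂_of_le (ξ x) (fun h => hne x (h ▸ hξ x)) le_rfl
      have := iSupIndep_weightSpace (F := F) (V := V) B ψ
      rw [htop, disjoint_top] at this
      exact hw0 ((Submodule.mem_bot F).1 (this ▸ hwψ))
    have hxS : (x : Submodule F V) ≤ S := by
      intro v hv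
      obtain ⟨c, hc⟩ := (finrank_eq_one_iff_of_nonzero' (⟨w, hx ▸ hwψ⟩ : (x : Submodule F V))
        (by simpa using hw0)).1 (hX1 x) ⟨v, hv⟩
      rw [← show c • w = v from congrArg Subtype.val hc]
      exact S.smul_mem c hwS
    refine hXtop S fun y => ?_
    obtain ⟨i, hi⟩ := hcyc x y
    rw [← hi]
    intro v hv
    obtain ⟨u, hu, rfl⟩ := (Submodule.mem_smul_pointwise_iff_exists _ _ _).1 hv
    exact hS _ (Subgroup.mem_sup_right ⟨i, rfl⟩) u (hxS hu)
  have hAnormal : A.Normal := MonoidHom.normal_ker φ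
  refine ⟨A, g, hAnormal, hAbot, ?_, ?_, hBirr A le_rfl hAnormal hAbot, hcent, ?_, ?_⟩
  · intro a ha b hb
    refine FaithfulSMul.eq_of_smul_eq_smul (α := V) (hext
      (DistribSMul.toLinearMap F V (a * b)) (DistribSMul.toLinearMap F V (b * a))
      fun x v hv => ?_)
    have h1 : a • v = χ x ⟨a, ha⟩ • v := hχ x hv ⟨a, ha⟩
    have h2 : b • v = χ x ⟨b, hb⟩ • v := hχ x hv ⟨b, hb⟩
    change (a * b) • v = (b * a) • v
    rw [← smul_smul, ← smul_smul, h1, h2, smul_comm a, smul_comm b, h1, h2, smul_comm]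
  · have hr : φ.range = Subgroup.zpowers (φ g) := by
      rw [MonoidHom.range_eq_map, ← hBirr A le_rfl hAnormal hAbot, Subgroup.map_sup,
        MonoidHom.map_zpowers, (Subgroup.map_eq_bot_iff A).2 le_rfl, bot_sup_eq]
    rw [hA, Subgroup.index_ker, hr, Nat.card_zpowers, hg]
  · intro B hBA hB
    refine or_iff_not_imp_left.2 fun hBbot => le_antisymm hBA fun a ha => ?_
    have haB : a ∈ B ⊔ Subgroup.zpowers g := hBirr B hBA hB hBbot ▸ Subgroup.mem_top a
    obtain ⟨b, hb, z, hz, rfl⟩ := Subgroup.mem_sup_of_normal_left.1 haB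
    have hzA : z ∈ A := (Subgroup.mul_mem_cancel_left _ (hBA hb)).1 ha
    obtain ⟨i, rfl⟩ := hz
    rw [hcent _ hzA (Commute.zpow_self g i), mul_one]
    exact hb
  · intro r hr
    obtain ⟨a, ha1⟩ := Subgroup.ne_bot_iff_exists_ne_one.1 hAbot
    obtain ⟨x, hx⟩ : ∃ x : X, χ x a ≠ 1 := by
      by_contra! h
      refine ha1 (Subtype.ext (FaithfulSMul.eq_of_smul_eq_smul (α := V) (hext
        (DistribSMul.toLinearMap F V (a : G)) (DistribSMul.toLinearMap F V 1)
        fun x v hv => ?_)))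
      change (a : G) • v = (1 : G) • v
      rw [hχ x hv a, h x, one_smul, one_smul]
    refine ⟨χ x a, ?_, hx⟩
    obtain ⟨v, hv, hv0⟩ := (Submodule.ne_bot_iff _).1 (hline _ (hX1 x)).1
    have hpow : ∀ n : ℕ, (a : G) ^ n • v = χ x a ^ n • v := by
      intro n
      induction n with
      | zero => simp
      | succ n ih => rw [pow_succ', ← smul_smul, ih, smul_comm, hχ x hv a, smul_smul, pow_succ]
    have h1 := hpow r
    rw [hr _ a.2, one_smul] at h1
    have h2 : (χ x a ^ r - 1) • v = 0 := by rw [sub_smul, ← h1, one_smul, sub_self]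
    exact sub_eq_zero.1 ((smul_eq_zero.1 h2).resolve_right hv0)

end Clifford

section PrimeCycle

open Module Polynomial
open scoped commutatorElement

/-- A simple module over `𝔽_r[X]` on which `X ^ r ^ s` acts as `X` has at most `r ^ s` elements. -/
theorem card_le_of_pow_eq_self {r : ℕ} [Fact r.Prime] {M : Type*} [AddCommGroup M]
    [Module (ZMod r) M] [Nontrivial M] (φ : Module.End (ZMod r) M) {s : ℕ} (hs : s ≠ 0)
    (hφ : φ ^ r ^ s = φ)
    (hsimple : ∀ U : Submodule (ZMod r) M, (∀ v ∈ U, φ v ∈ U) → U = ⊥ ∨ U = ⊤) :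
    Nat.card M ≤ r ^ s := by
  have hM : IsSimpleModule (ZMod r)[X] (AEval' φ) := by
    have : Nontrivial (AEval' φ) := inferInstanceAs (Nontrivial M)
    refine { eq_bot_or_eq_top := fun U => ?_ }
    refine (hsimple ((U.restrictScalars (ZMod r)).comap (AEval'.of φ).toLinearMap)
      fun v hv => ?_).imp (fun h => ?_) fun h => ?_
    · exact (AEval'.X_smul_of φ v) ▸ U.smul_mem X hv
    · exact (Submodule.eq_bot_iff _).2 fun x hx => (Submodule.eq_bot_iff _).1 h x hx
    · exact eq_top_iff.2 fun x _ => (Submodule.eq_top_iff'.1 h) ((AEval'.of φ).symm x)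
  obtain ⟨I, hI, ⟨e⟩⟩ := isSimpleModule_iff_quot_maximal.1 hM
  let K := (ZMod r)[X] ⧸ I
  let _ : Field K := Ideal.Quotient.field I
  have : Algebra (ZMod r) K := inferInstanceAs (Algebra (ZMod r) ((ZMod r)[X] ⧸ I))
  have hchar : CharP K r := charP_of_injective_algebraMap (algebraMap (ZMod r) K).injective r
  have hX : (X ^ r ^ s : (ZMod r)[X]) • (e.symm 1) = (X : (ZMod r)[X]) • e.symm 1 := by
    have := AEval'.X_pow_smul_of φ ((AEval'.of φ).symm (e.symm 1)) (r ^ s)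
    rw [hφ] at this
    exact this.trans (AEval'.X_smul_of φ _).symm
  have hXK : (Ideal.Quotient.mk I X : K) ^ r ^ s = Ideal.Quotient.mk I X := by
    rw [← map_smul, ← map_smul] at hX
    have := e.symm.injective hX
    simpa [Algebra.smul_def] using this
  have hK : ∀ t : K, t ^ r ^ s = t := by
    intro t
    obtain ⟨f, rfl⟩ := Ideal.Quotient.mk_surjective t
    induction f using Polynomial.induction_on with
    | C a => rw [← map_pow, ← C_pow, ZMod.pow_card_pow]
    | add f h hf hh => rw [map_add, add_pow_char_pow, hf, hh]
    | monomial n a h =>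
      rw [pow_succ, ← mul_assoc, map_mul, mul_pow, h, hXK]
  have hr1 : 1 < r ^ s := Nat.one_lt_pow hs (Fact.out : r.Prime).one_lt
  have hP : (X ^ r ^ s - X : K[X]) ≠ 0 := FiniteField.X_pow_card_sub_X_ne_zero K hr1
  have hcard : Nat.card K ≤ r ^ s := by
    classical
    have hroot : ∀ t : K, t ∈ (X ^ r ^ s - X : K[X]).roots.toFinset := fun t => by
      rw [Multiset.mem_toFinset, mem_roots hP]
      simp [IsRoot, hK t]
    have : Fintype K := ⟨_, hroot⟩
    rw [Nat.card_eq_fintype_card]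
    calc Fintype.card K ≤ (X ^ r ^ s - X : K[X]).roots.toFinset.card :=
          Finset.card_le_card fun t _ => hroot t
      _ ≤ (X ^ r ^ s - X : K[X]).roots.card := Multiset.toFinset_card_le _
      _ ≤ _ := card_roots' _
      _ = r ^ s := FiniteField.X_pow_card_sub_X_natDegree_eq K hr1
  exact (Nat.card_congr e.toEquiv).trans_le hcard

/-- A nontrivial elementary abelian `r`-group without proper nontrivial subgroups invariant under
an automorphism of order dividing `r ^ s - 1` has at most `r ^ s` elements. -/
theorem card_le_of_mulAut {r p s : ℕ} [Fact r.Prime] {M : Type*} [CommGroup M] [Nontrivial M]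
    [Module (ZMod r) (Additive M)] {c : MulAut M} (hs : s ≠ 0) (hc : c ^ p = 1)
    (hrs : r ^ s ≡ 1 [MOD p])
    (hsimple : ∀ U : Subgroup M, (∀ a ∈ U, c a ∈ U) → U = ⊥ ∨ U = ⊤) :
    Nat.card M ≤ r ^ s := by
  let φ : Module.End (ZMod r) (Additive M) :=
    (MonoidHom.toAdditive c.toMonoidHom).toZModLinearMap r
  have hpow : ∀ (n : ℕ) (a : M),
      (φ ^ n) (Additive.ofMul a) = Additive.ofMul ((c ^ n) a) := by
    intro n a
    induction n generalizing a with
    | zero => rfl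
    | succ n ih =>
      rw [pow_succ, pow_succ]
      exact ih (c a)
  have hφ : φ ^ r ^ s = φ := by
    have h1 : c ^ r ^ s = c ^ 1 := pow_eq_pow_iff_modEq.2
      (hrs.of_dvd (orderOf_dvd_of_pow_eq_one hc))
    ext a
    refine (hpow (r ^ s) a.toMul).trans ?_
    rw [h1, pow_one]
    rfl
  refine (Nat.card_congr Additive.ofMul).trans_le
    (card_le_of_pow_eq_self φ hs hφ fun U hU => ?_)
  refine (hsimple (AddSubgroup.toSubgroup' U.toAddSubgroup) fun a ha => hU (Additive.ofMul a) ha).imp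
    (fun h => ?_) fun h => ?_
  · exact (Submodule.eq_bot_iff _).2 fun x hx => (Subgroup.eq_bot_iff_forall _).1 h x.toMul hx
  · exact Submodule.eq_top_iff'.2 fun x => (Subgroup.eq_top_iff' _).1 h x.toMul

variable {G : Type*} [Group G] [Finite G]

/-- If `G` is the extension of an abelian minimal normal subgroup `A` by a cyclic group of prime
order `p` with a generator acting fixed-point-freely, then `A` is elementary abelian, its order is
determined by its exponent and `p`, and it is the derived subgroup. -/
theorem exists_card_eq_pow_orderOf {p : ℕ} (hp : p.Prime) {A : Subgroup G} {g : G}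
    (hA : A.Normal) (hbot : A ≠ ⊥) (hcomm : ∀ a ∈ A, ∀ b ∈ A, a * b = b * a)
    (hidx : A.index = p) (hgen : A ⊔ Subgroup.zpowers g = ⊤)
    (hcent : ∀ a ∈ A, a * g = g * a → a = 1)
    (hmin : ∀ B ≤ A, B.Normal → B = ⊥ ∨ B = A) :
    ∃ r : ℕ, r.Prime ∧ r ≠ p ∧ (∀ a ∈ A, a ^ r = 1) ∧
      Nat.card A = r ^ orderOf (r : ZMod p) ∧ commutator G = A := by
  classical
  have : Fact p.Prime := ⟨hp⟩
  have hnormal : ∀ B ≤ A, (∀ b ∈ B, g * b * g⁻¹ ∈ B) → B.Normal := by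
    intro B hBA hB
    have hle : A ⊔ Subgroup.zpowers g ≤ Subgroup.normalizer (B : Set G) := by
      refine sup_le (fun a ha => ?_) (Subgroup.zpowers_le.2 ?_)
      · refine Subgroup.mem_normalizer_iff.2 fun b => ?_
        constructor
        · intro hb
          rwa [hcomm a ha b (hBA hb), mul_inv_cancel_right]
        · intro hb
          have := hcomm a ha _ (hBA hb)
          rw [← mul_assoc, ← mul_assoc] at this
          have h2 : a * b * a⁻¹ = b := by
            have h3 := congrArg (fun x => a⁻¹ * x) this
            simp only [mul_assoc, inv_mul_cancel, mul_one, inv_mul_cancel_left] at h3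
            rw [← mul_assoc] at h3
            exact h3
          rwa [h2] at hb
      · have : Finite B := inferInstance
        exact Subgroup.mem_normalizer_fintype hB
    rw [hgen, top_le_iff] at hle
    exact Subgroup.normalizer_eq_top_iff.1 hle
  have hAcard : Nat.card A ≠ 1 := fun h => hbot (Subgroup.card_eq_one.1 h)
  obtain ⟨r, hr, hrA⟩ := Nat.exists_prime_and_dvd hAcard
  have : Fact r.Prime := ⟨hr⟩
  let T : Subgroup G :=
    { carrier := {a | a ∈ A ∧ a ^ r = 1}
      one_mem' := ⟨A.one_mem, one_pow r⟩
      mul_mem' := fun {a b} ha hb => ⟨A.mul_mem ha.1 hb.1, by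
        rw [(show Commute a b from hcomm a ha.1 b hb.1).mul_pow, ha.2, hb.2, one_mul]⟩
      inv_mem' := fun {a} ha => ⟨A.inv_mem ha.1, by rw [inv_pow, ha.2, inv_one]⟩ }
  have hTA : T = A := by
    refine (hmin T (fun a ha => ha.1) (hnormal T (fun a ha => ha.1) fun b hb =>
      ⟨hA.conj_mem b hb.1 g, by rw [conj_pow, hb.2, mul_one, mul_inv_cancel]⟩)).resolve_left
      fun h => ?_
    obtain ⟨a, ha⟩ := exists_prime_orderOf_dvd_card' r hrA
    have haT : (a : G) ∈ T := ⟨a.2, by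
      rw [← ha, ← Subgroup.orderOf_coe, pow_orderOf_eq_one]⟩
    rw [h, Subgroup.mem_bot] at haT
    rw [Subtype.ext (a2 := (1 : A)) haT, orderOf_one] at ha
    exact hr.one_lt.ne ha
  have hexp : ∀ a ∈ A, a ^ r = 1 := fun a ha => by
    rw [← hTA] at ha
    exact ha.2
  let _ : CommGroup A :=
    { (inferInstance : Group A) with
      mul_comm := fun a b => Subtype.ext (hcomm a a.2 b b.2) }
  let c : MulAut A := MulAut.conjNormal g
  have hc : ∀ a : A, (c a : G) = g * a * g⁻¹ := fun a => MulAut.conjNormal_apply g a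
  have hcp : c ^ p = 1 := by
    have hgp : g ^ p ∈ A := hidx ▸ A.pow_index_mem g
    rw [← map_pow]
    ext a
    rw [MulAut.conjNormal_apply, hcomm _ hgp a a.2, mul_inv_cancel_right]
    rfl
  have hfix : ∀ a : A, c a = a → a = 1 := by
    intro a ha
    have h1 : g * a * g⁻¹ = a := by rw [← hc, ha]
    refine Subtype.ext (hcent a a.2 ?_)
    rw [mul_inv_eq_iff_eq_mul] at h1
    exact h1.symm
  have hmod : Nat.card A ≡ 1 [MOD p] := by
    have := Fintype.ofFinite A
    let f : Function.End A := fun a => c a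
    have hpow : ∀ n : ℕ, f ^ n = fun a => (c ^ n : MulAut A) a := by
      intro n
      induction n with
      | zero => rfl
      | succ n ih => rw [pow_succ, ih, pow_succ]; rfl
    have hf : f ^ p ^ 1 = 1 := by rw [pow_one, hpow, hcp]; rfl
    have h1 := Equiv.Perm.card_fixedPoints_modEq hf
    rw [Nat.card_eq_fintype_card]
    have : Fintype.card (Function.fixedPoints f) = 1 := by
      rw [Fintype.card_eq_one_iff]
      exact ⟨⟨1, map_one c⟩, fun a => Subtype.ext (hfix a a.2)⟩
    rwa [this] at h1
  obtain ⟨m, hm⟩ : ∃ m : ℕ, Nat.card A = r ^ m :=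
    IsPGroup.iff_card.1 fun a => ⟨1, Subtype.ext (by simpa using hexp a a.2)⟩
  have hm0 : m ≠ 0 := by
    rintro rfl
    exact hAcard hm
  have hrp : r ≠ p := by
    rintro rfl
    rw [hm] at hmod
    have h1 : r ∣ r ^ m := dvd_pow_self r hm0
    have h2 := (Nat.modEq_zero_iff_dvd.2 h1).symm.trans hmod
    exact hr.one_lt.ne' (Nat.dvd_one.1 ((Nat.modEq_zero_iff_dvd).1 h2.symm))
  set s := orderOf (r : ZMod p) with hs
  have hsm : s ∣ m := by
    refine orderOf_dvd_of_pow_eq_one ?_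
    rw [hm, ← ZMod.natCast_eq_natCast_iff] at hmod
    simpa using hmod
  have hs0 : s ≠ 0 := by
    rintro h
    exact hm0 (Nat.eq_zero_of_zero_dvd (h ▸ hsm))
  have hrs : r ^ s ≡ 1 [MOD p] := by
    rw [← ZMod.natCast_eq_natCast_iff]
    push_cast
    rw [hs, pow_orderOf_eq_one]
  refine ⟨r, hr, hrp, hexp, le_antisymm ?_ ?_, ?_⟩
  · have : Nontrivial A := (Subgroup.nontrivial_iff_ne_bot A).2 hbot
    let _ : Module (ZMod r) (Additive A) :=
      AddCommGroup.zmodModule fun a => Subtype.ext (hexp _ a.toMul.2)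
    refine card_le_of_mulAut (c := c) hs0 hcp hrs fun U hU => ?_
    let B : Subgroup G := U.map A.subtype
    have hBA : B ≤ A := Subgroup.map_subtype_le _
    rcases hmin B hBA (hnormal B hBA (by
      rintro _ ⟨a, ha, rfl⟩
      exact ⟨c a, hU _ ha, hc a⟩)) with h | h
    · exact Or.inl ((Subgroup.map_eq_bot_iff_of_injective _ A.subtype_injective).1 h)
    · refine Or.inr (Subgroup.map_injective A.subtype_injective ?_)
      rw [← MonoidHom.range_eq_map, Subgroup.range_subtype]
      exact h
  · rw [hm]
    exact Nat.pow_le_pow_right hr.pos (Nat.le_of_dvd (Nat.pos_of_ne_zero hm0) hsm)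
  · have hle : commutator G ≤ A := by
      have : Fact (Nat.card (G ⧸ A)).Prime := ⟨by
        rw [← Subgroup.index_eq_card, hidx]; exact hp⟩
      have : IsCyclic (G ⧸ A) := isCyclic_of_prime_card rfl
      exact Subgroup.Normal.commutator_le_of_self_sup_commutative_eq_top hgen inferInstance
    refine (hmin _ hle inferInstance).resolve_left fun h => hbot ?_
    refine (Subgroup.eq_bot_iff_forall _).2 fun a ha => hcent a ha ?_
    have h1 : ⁅a, g⁆ ∈ commutator G :=
      Subgroup.commutator_mem_commutator (Subgroup.mem_top a) (Subgroup.mem_top g)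
    rw [h, Subgroup.mem_bot] at h1
    exact commutatorElement_eq_one_iff_mul_comm.1 h1

end PrimeCycle

section RowAction

variable {n : ℕ} {F : Type*} [Field F]

theorem natAct_one : natAct (1 : GL (Fin n) F) = LinearMap.id :=
  LinearMap.ext fun v => Matrix.vecMul_one v

theorem natAct_mul_apply (g h : GL (Fin n) F) (v : Fin n → F) :
    natAct (g * h) v = natAct h (natAct g v) :=
  (Matrix.vecMul_vecMul v (g : Matrix (Fin n) (Fin n) F) (h : Matrix (Fin n) (Fin n) F)).symm

/-- The left action on row vectors in which `g` multiplies on the right by `g⁻¹`. It differs from the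
action of `Subgroup.instMulAction`, so `one_smul` and its relatives need the instance spelled out. -/
instance rowAction (G : Subgroup (GL (Fin n) F)) : DistribMulAction G (Fin n → F) where
  smul g v := natAct (g : GL (Fin n) F)⁻¹ v
  one_smul v := by
    change natAct ((1 : G) : GL (Fin n) F)⁻¹ v = v
    rw [Subgroup.coe_one, inv_one, natAct_one, LinearMap.id_apply]
  mul_smul g h v := by
    change natAct ((g * h : G) : GL (Fin n) F)⁻¹ v = natAct _ (natAct _ v)
    rw [Subgroup.coe_mul, mul_inv_rev, natAct_mul_apply]
  smul_zero g := map_zero (natAct (g : GL (Fin n) F)⁻¹)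
  smul_add g := map_add (natAct (g : GL (Fin n) F)⁻¹)

variable {G : Subgroup (GL (Fin n) F)}

theorem rowAction_smul_def (g : G) (v : Fin n → F) :
    g • v = natAct (g : GL (Fin n) F)⁻¹ v := rfl

instance : SMulCommClass G F (Fin n → F) where
  smul_comm g c v := map_smul (natAct (g : GL (Fin n) F)⁻¹) c v

instance : FaithfulSMul G (Fin n → F) where
  eq_of_smul_eq_smul {g h} hgh := by
    have h1 : natAct (g : GL (Fin n) F)⁻¹ = natAct (h : GL (Fin n) F)⁻¹ := LinearMap.ext hgh
    refine Subtype.ext (inv_injective (Units.ext (Matrix.ext fun i j => ?_)))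
    have h2 := congrFun (congrArg (fun f => f (Pi.single i 1)) h1) j
    simpa [natAct] using h2

theorem irreducibleUnder_iff_isIrred (H : Subgroup G) :
    IrreducibleUnder F (Fin n → F) H ↔ IsIrred (H.map G.subtype) := by
  refine forall_congr' fun S => imp_congr_left ⟨fun h => ?_, fun h g hg v hv => ?_⟩
  · rintro _ ⟨g, hg, rfl⟩
    refine le_antisymm ?_ fun v hv => ⟨g • v, h g hg v hv, ?_⟩
    · rintro _ ⟨v, hv, rfl⟩
      have := h g⁻¹ (H.inv_mem hg) v hv
      rwa [rowAction_smul_def, Subgroup.coe_inv, inv_inv] at this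
    · rw [rowAction_smul_def]
      change natAct (g : GL (Fin n) F) _ = v
      rw [← natAct_mul_apply, inv_mul_cancel, natAct_one, LinearMap.id_apply]
  · rw [← h _ (Subgroup.mem_map_of_mem G.subtype (H.inv_mem hg))]
    exact Submodule.mem_map_of_mem hv

theorem wedge2Map_smul_id {V : Type*} [AddCommGroup V] [Module F V] (c : F) (w : Wedge2 F V) :
    wedge2Map (c • LinearMap.id) w = (c * c) • w := by
  obtain ⟨x, rfl⟩ := Submodule.Quotient.mk_surjective _ w
  rw [wedge2Map, Submodule.mapQ_apply, TensorProduct.map_smul_left, TensorProduct.map_smul_right,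
    TensorProduct.map_id, smul_smul]
  rfl

/-- A linear group whose natural module is ESQ contains no nontrivial scalars. -/
theorem IsESQ.eq_one_of_smul_eq (hG : IsESQ G) {g : G} {c : F}
    (hg : ∀ v : Fin n → F, g • v = c • v) : g = 1 := by
  obtain ⟨U, e, -, he⟩ := hG
  refine FaithfulSMul.eq_of_smul_eq_smul (α := Fin n → F) fun v => ?_
  have hact : natAct (g : GL (Fin n) F)⁻¹ = c • LinearMap.id := LinearMap.ext hg
  have hsq : ∀ v : Fin n → F, (c * c) • v = c • v := by
    intro v
    obtain ⟨w, hw⟩ := Submodule.Quotient.mk_surjective _ (e.symm v)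
    have h1 := he _ (G.inv_mem g.2) w
    rw [hact, wedge2Map_smul_id, Submodule.Quotient.mk_smul, map_smul, hw,
      LinearEquiv.apply_symm_apply] at h1
    exact h1
  have h2 : g • g • v = g • v := by rw [hg (g • v), hg v, smul_smul, hsq]
  exact (@MulAction.injective G (Fin n → F) _ (rowAction G).toMulAction g _ _ h2).trans
    ((rowAction G).toMulAction.one_smul v).symm

end RowAction

theorem natCast_card_eq_one_of_pow_eq_one {F : Type*} [Field F] [Fintype F] {r : ℕ}
    (hr : r.Prime) {c : F} (hc : c ^ r = 1) (hc1 : c ≠ 1) :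
    (Fintype.card F : ZMod r) = 1 := by
  have : Fact r.Prime := ⟨hr⟩
  have hc0 : c ≠ 0 := by
    rintro rfl
    simp [hr.ne_zero] at hc
  have hdvd : r ∣ Fintype.card F - 1 := by
    rw [← orderOf_eq_prime hc hc1]
    exact orderOf_dvd_of_pow_eq_one (FiniteField.pow_card_sub_one_eq_one c hc0)
  rw [← Nat.sub_add_cancel (Fintype.card_pos (α := F)), Nat.cast_add,
    (ZMod.natCast_eq_zero_iff _ _).2 hdvd, zero_add, Nat.cast_one]

theorem stmt13 (p : ℕ) (hp : p.Prime) (F : Type) [Field F] [Fintype F]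
    (G : Subgroup (GL (Fin p) F)) (hG : IsMinIrredESQ G)
    (habs : IsAbsIrred G) (hns : ¬ IsSimpleGroup G) :
    ∃ r s : ℕ, r.Prime ∧ r ≠ p ∧
      -- `r` divides `q − 1`, i.e. `ord_r(q) = 1`
      ((Fintype.card F : ZMod r)) = 1 ∧
      -- `s` is the multiplicative order of `r` modulo `p`
      s = orderOf ((r : ZMod p)) ∧
      Nat.card G = p * r ^ s ∧
      -- the derived subgroup is elementary abelian of order `r^s`
      Nat.card (commutator G) = r ^ s ∧
      (∀ x : commutator G, x ^ r = 1) ∧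
      (∀ x y : commutator G, x * y = y * x) ∧
      -- `G/G'` has order `p`
      Nat.card (G ⧸ commutator G) = p ∧
      -- and acts irreducibly on `G'` by conjugation
      (∀ H : Subgroup G, H ≤ commutator G →
        (∀ g : G, ∀ h ∈ H, g * h * g⁻¹ ∈ H) →
        H = ⊥ ∨ H = commutator G) := by
  classical
  have hfr : Module.finrank F (Fin p → F) = p := Module.finrank_fin_fun F
  obtain ⟨A, g, hA, hbot, hcomm, hidx, hgen, hcent, hmin, hroot⟩ :=
    exists_minimal_normal_of_minimal_irreducible (F := F) (V := Fin p → F) (G := G)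
      (hfr.symm ▸ hp)
      (by
        rw [irreducibleUnder_iff_isIrred, ← MonoidHom.range_eq_map, Subgroup.range_subtype]
        exact hG.1)
      (fun H hH h => by
        refine hG.2.2 _ (lt_of_le_of_ne (Subgroup.map_subtype_le H) fun hHG => hH ?_)
          ((irreducibleUnder_iff_isIrred H).1 h)
        refine Subgroup.map_injective G.subtype_injective ?_
        rw [hHG, ← MonoidHom.range_eq_map, Subgroup.range_subtype])
      (fun _ _ => hG.2.1.eq_one_of_smul_eq) hns
  rw [hfr] at hidx
  obtain ⟨r, hr, hrp, hexp, hcard, rfl⟩ :=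
    exists_card_eq_pow_orderOf hp hA hbot hcomm hidx hgen hcent hmin
  obtain ⟨c, hc, hc1⟩ := hroot r hexp
  refine ⟨r, _, hr, hrp, natCast_card_eq_one_of_pow_eq_one hr hc hc1, rfl, ?_, hcard,
    fun x => Subtype.ext (hexp x x.2), fun x y => Subtype.ext (hcomm x x.2 y y.2), hidx,
    fun H hH hconj => hmin H hH ⟨fun h hh k => hconj k h hh⟩⟩
  rw [← Subgroup.index_mul_card (commutator G), hidx, hcard]
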